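/- Fix n ≥ 1. Let 𝔄_n be the structure over signature {R₁,R₂,R₃,R₄} (all binary) with domain {a} ∪ {a_w : w a binary word with |w| ≤ n}, and relations: R₁ consists of the single pair (a_{0ⁿ}, a); R₂ consists of the pairs (a_w, a_{w0}) and (a_w, a_{w1}) for all |w| < n, together with the loop (a_ε, a_ε); R₃ consists of all pairs (a_w, a_u) with u a proper prefix of w, together with loops at a_ε and at every leaf a_w with |w| = n; R₄ consists of the single pair (a, a_ε). Let 𝔅_n be obtained from 𝔄_n by removing the R₁-edge (a_{0ⁿ}, a). Then every ∃-bounded first-order sentence of quantifier rank at most n that is true in 𝔄_n is also true in 𝔅_n. -/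

import Mathlib

/-- A frame: a first-order structure over a signature consisting of
binary relation symbols indexed by `I`. -/
structure KFrame (I : Type) where
  W : Type
  R : I → W → W → Prop

/-- First-order formulas over a signature of binary relation symbols indexed
by `I`, with variables indexed by `ℕ`. -/
inductive FO (I : Type) : Type
  | eq : ℕ → ℕ → FO I
  | rel : I → ℕ → ℕ → FO I
  | fal : FO I
  | neg : FO I → FO I
  | and : FO I → FO I → FO I
  | or : FO I → FO I → FO I
  | imp : FO I → FO I → FO I
  | ex : ℕ → FO I → FO I
  | all : ℕ → FO I → FO I

/-- Tarskian satisfaction of a first-order formula in a frame, relative to a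
variable assignment `g`. -/
def FOSat {I : Type} (F : KFrame I) : (ℕ → F.W) → FO I → Prop
  | g, .eq x y => g x = g y
  | g, .rel i x y => F.R i (g x) (g y)
  | _, .fal => False
  | g, .neg φ => ¬ FOSat F g φ
  | g, .and φ ψ => FOSat F g φ ∧ FOSat F g ψ
  | g, .or φ ψ => FOSat F g φ ∨ FOSat F g ψ
  | g, .imp φ ψ => FOSat F g φ → FOSat F g ψ
  | g, .ex x φ => ∃ d : F.W, FOSat F (Function.update g x d) φ
  | g, .all x φ => ∀ d : F.W, FOSat F (Function.update g x d) φ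

/-- The free variables of a first-order formula. -/
def freeVars {I : Type} : FO I → Finset ℕ
  | .eq x y => {x, y}
  | .rel _ x y => {x, y}
  | .fal => ∅
  | .neg φ => freeVars φ
  | .and φ ψ => freeVars φ ∪ freeVars ψ
  | .or φ ψ => freeVars φ ∪ freeVars ψ
  | .imp φ ψ => freeVars φ ∪ freeVars ψ
  | .ex x φ => freeVars φ \ {x}
  | .all x φ => freeVars φ \ {x}

/-- Truth of a (closed) first-order formula in a frame. -/
def FrameSat {I : Type} (F : KFrame I) (φ : FO I) : Prop :=
  ∀ g : ℕ → F.W, FOSat F g φ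

/-- ∃-bounded first-order formulas: built up from literals (including equality
literals) using conjunction, disjunction, bounded quantification of the forms
`∃x(R(y,x) ∧ …)` and `∀x(R(y,x) → …)` (with `y` distinct from `x`), and,
additionally, unrestricted universal quantification. -/
inductive ExBounded {I : Type} : FO I → Prop
  | eq (x y : ℕ) : ExBounded (.eq x y)
  | neq (x y : ℕ) : ExBounded (.neg (.eq x y))
  | rel (i : I) (x y : ℕ) : ExBounded (.rel i x y)
  | nrel (i : I) (x y : ℕ) : ExBounded (.neg (.rel i x y))
  | and {φ ψ : FO I} : ExBounded φ → ExBounded ψ → ExBounded (.and φ ψ)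
  | or {φ ψ : FO I} : ExBounded φ → ExBounded ψ → ExBounded (.or φ ψ)
  | bex (i : I) (y x : ℕ) {φ : FO I} :
      x ≠ y → ExBounded φ → ExBounded (.ex x (.and (.rel i y x) φ))
  | ball (i : I) (y x : ℕ) {φ : FO I} :
      x ≠ y → ExBounded φ → ExBounded (.all x (.imp (.rel i y x) φ))
  | uall (x : ℕ) {φ : FO I} : ExBounded φ → ExBounded (.all x φ)

/-- Quantifier rank. -/
def qrank {I : Type} : FO I → ℕ
  | .eq _ _ => 0
  | .rel _ _ _ => 0
  | .fal => 0
  | .neg φ => qrank φ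
  | .and φ ψ => max (qrank φ) (qrank ψ)
  | .or φ ψ => max (qrank φ) (qrank ψ)
  | .imp φ ψ => max (qrank φ) (qrank ψ)
  | .ex _ φ => qrank φ + 1
  | .all _ φ => qrank φ + 1

/-- Binary words of length at most `n` (`false` plays the role of `0`). -/
abbrev BWord (n : ℕ) := {w : List Bool // w.length ≤ n}

/-- The structure `𝔄ₙ` (when `withR1 = True`) resp. `𝔅ₙ` (when `withR1 = False`):
the domain is a distinguished element `a` (encoded as `none`) together with the
elements `a_w` for binary words `w` with `|w| ≤ n` (encoded as `some w`).
Relation indices in `Fin 4`: `R₁ = 0`, `R₂ = 1`, `R₃ = 2`, `R₄ = 3`.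
`R₁` consists of the single pair `(a_{0ⁿ}, a)` (present only if `withR1`);
`R₂` of the tree edges `(a_w, a_{w0})`, `(a_w, a_{w1})` plus the loop at `a_ε`;
`R₃` of the pairs `(a_w, a_u)` with `u` a proper prefix of `w`, plus loops at
`a_ε` and at the leaves; `R₄` of the single pair `(a, a_ε)`. -/
def AFrame (n : ℕ) (withR1 : Prop) : KFrame (Fin 4) where
  W := Option (BWord n)
  R := fun i x y =>
    if i = 0 then
      withR1 ∧ (∃ u : BWord n, x = some u ∧ u.1 = List.replicate n false) ∧ y = none
    else if i = 1 then
      ∃ u v : BWord n, x = some u ∧ y = some v ∧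
        ((∃ b : Bool, v.1 = u.1 ++ [b]) ∨ (u.1 = [] ∧ v.1 = []))
    else if i = 2 then
      ∃ u v : BWord n, x = some u ∧ y = some v ∧
        ((v.1 <+: u.1 ∧ v.1 ≠ u.1) ∨ (u = v ∧ (u.1 = [] ∨ u.1.length = n)))
    else
      x = none ∧ ∃ v : BWord n, y = some v ∧ v.1 = []

/-- Satisfaction depends only on the values of the free variables. -/
theorem FOSat_congr {I : Type} (F : KFrame I) (φ : FO I) (g h : ℕ → F.W)
    (hgh : ∀ x ∈ freeVars φ, g x = h x) : FOSat F g φ ↔ FOSat F h φ := by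
  have hupd : ∀ (ψ : FO I) (g h : ℕ → F.W) (x : ℕ) (d : F.W),
      (∀ z ∈ freeVars ψ \ {x}, g z = h z) →
      ∀ z ∈ freeVars ψ, Function.update g x d z = Function.update h x d z := by
    intro ψ g h x d hgh z hz
    by_cases hzx : z = x
    · subst hzx; simp
    · simpa [hzx] using hgh z (by simp [hz, hzx])
  induction φ generalizing g h with
  | eq x y => simp [FOSat, hgh x (by simp [freeVars]), hgh y (by simp [freeVars])]
  | rel i x y => simp [FOSat, hgh x (by simp [freeVars]), hgh y (by simp [freeVars])]
  | fal => simp [FOSat]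
  | neg φ ih => simpa [FOSat] using not_congr (ih g h hgh)
  | and φ ψ ih₁ ih₂ =>
    exact and_congr (ih₁ g h fun x hx => hgh x (Finset.mem_union_left _ hx))
      (ih₂ g h fun x hx => hgh x (Finset.mem_union_right _ hx))
  | or φ ψ ih₁ ih₂ =>
    exact or_congr (ih₁ g h fun x hx => hgh x (Finset.mem_union_left _ hx))
      (ih₂ g h fun x hx => hgh x (Finset.mem_union_right _ hx))
  | imp φ ψ ih₁ ih₂ =>
    exact imp_congr (ih₁ g h fun x hx => hgh x (Finset.mem_union_left _ hx))
      (ih₂ g h fun x hx => hgh x (Finset.mem_union_right _ hx))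
  | ex x φ ih => exact exists_congr fun d => ih _ _ (hupd φ g h x d hgh)
  | all x φ ih => exact forall_congr' fun d => ih _ _ (hupd φ g h x d hgh)

/-- Satisfaction is invariant under automorphisms. -/
theorem FOSat_comp_equiv {I : Type} (F : KFrame I) (e : F.W ≃ F.W)
    (he : ∀ i x y, F.R i (e x) (e y) ↔ F.R i x y) (φ : FO I) (g : ℕ → F.W) :
    FOSat F (e ∘ g) φ ↔ FOSat F g φ := by
  induction φ generalizing g with
  | eq x y => simp [FOSat]
  | rel i x y => simp [FOSat, he]
  | fal => simp [FOSat]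
  | neg φ ih => exact not_congr (ih g)
  | and φ ψ ih₁ ih₂ => exact and_congr (ih₁ g) (ih₂ g)
  | or φ ψ ih₁ ih₂ => exact or_congr (ih₁ g) (ih₂ g)
  | imp φ ψ ih₁ ih₂ => exact imp_congr (ih₁ g) (ih₂ g)
  | ex x φ ih =>
    refine (e.exists_congr fun d => ?_).symm
    rw [← Function.comp_update, ih]
  | all x φ ih =>
    refine (e.forall_congr fun d => ?_).symm
    rw [← Function.comp_update, ih]

/-- Swap the two subtrees below the node `0ᵏ`: flip the letter following the prefix `0ᵏ`,
and leave words without such a letter unchanged. -/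
def swapBelow : ℕ → List Bool → List Bool
  | _, [] => []
  | 0, b :: l => (!b) :: l
  | _ + 1, true :: l => true :: l
  | k + 1, false :: l => false :: swapBelow k l

theorem swapBelow_length (k : ℕ) (l : List Bool) : (swapBelow k l).length = l.length := by
  fun_induction swapBelow k l <;> simp_all

theorem swapBelow_swapBelow (k : ℕ) (l : List Bool) : swapBelow k (swapBelow k l) = l := by
  fun_induction swapBelow k l <;> simp_all [swapBelow]

theorem swapBelow_eq_nil (k : ℕ) (l : List Bool) : swapBelow k l = [] ↔ l = [] := by
  rw [← List.length_eq_zero_iff, swapBelow_length, List.length_eq_zero_iff]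

theorem swapBelow_append (k : ℕ) (l t : List Bool) :
    ∃ s, swapBelow k (l ++ t) = swapBelow k l ++ s := by
  fun_induction swapBelow k l <;> simp_all [swapBelow]

theorem swapBelow_prefix {k : ℕ} {u v : List Bool} (h : u <+: v) :
    swapBelow k u <+: swapBelow k v := by
  obtain ⟨t, rfl⟩ := h
  obtain ⟨s, hs⟩ := swapBelow_append k u t
  exact ⟨s, hs.symm⟩

theorem swapBelow_concat (k : ℕ) (l : List Bool) (b : Bool) :
    ∃ c, swapBelow k (l ++ [b]) = swapBelow k l ++ [c] := by
  obtain ⟨s, hs⟩ := swapBelow_append k l [b]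
  have hlen := congrArg List.length hs
  simp only [swapBelow_length, List.length_append, List.length_singleton] at hlen
  obtain ⟨c, rfl⟩ := List.length_eq_one_iff.mp (show s.length = 1 by omega)
  exact ⟨c, hs⟩

theorem swapBelow_eq_self {k : ℕ} {l : List Bool}
    (h : ¬ List.replicate k false <+: l) : swapBelow k l = l := by
  fun_induction swapBelow k l <;> simp_all [List.replicate_succ]

theorem not_prefix_swapBelow {k : ℕ} {l : List Bool}
    (h : List.replicate (k + 1) false <+: l) :
    ¬ List.replicate (k + 1) false <+: swapBelow k l := by
  fun_induction swapBelow k l <;> simp_all [List.replicate_succ]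

/-- `swapBelow` as a permutation of the domain of `AFrame`. -/
def swapEquiv (n k : ℕ) : Option (BWord n) ≃ Option (BWord n) :=
  Equiv.optionCongr <| Function.Involutive.toPerm
    (fun u : BWord n => ⟨swapBelow k u.1, by rw [swapBelow_length]; exact u.2⟩)
    (fun u => Subtype.ext (swapBelow_swapBelow k u.1))

theorem swapEquiv_some (n k : ℕ) (u : BWord n) :
    swapEquiv n k (some u) =
      some ⟨swapBelow k u.1, by rw [swapBelow_length]; exact u.2⟩ := rfl

theorem swapEquiv_swapEquiv (n k : ℕ) (x : Option (BWord n)) :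
    swapEquiv n k (swapEquiv n k x) = x := by
  cases x with
  | none => rfl
  | some u => simp [swapEquiv_some, swapBelow_swapBelow]

theorem AFrame_false_R_swapEquiv (n k : ℕ) (i : Fin 4) (x y : Option (BWord n)) :
    (AFrame n False).R i (swapEquiv n k x) (swapEquiv n k y) ↔ (AFrame n False).R i x y := by
  have key : ∀ x y, (AFrame n False).R i x y →
      (AFrame n False).R i (swapEquiv n k x) (swapEquiv n k y) := by
    intro x y h
    unfold AFrame at h ⊢
    dsimp only at h ⊢
    split_ifs at h ⊢
    · exact h.1.elim
    · obtain ⟨u, v, rfl, rfl, h⟩ := h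
      refine ⟨_, _, swapEquiv_some n k u, swapEquiv_some n k v, ?_⟩
      rcases h with ⟨b, hb⟩ | ⟨hu, hv⟩
      · left
        simp only [hb]
        exact swapBelow_concat k u.1 b
      · right
        simp [hu, hv, swapBelow]
    · obtain ⟨u, v, rfl, rfl, h⟩ := h
      refine ⟨_, _, swapEquiv_some n k u, swapEquiv_some n k v, ?_⟩
      rcases h with ⟨hp, hne⟩ | ⟨rfl, h⟩
      · exact .inl ⟨swapBelow_prefix hp,
          (Function.LeftInverse.injective (swapBelow_swapBelow k)).ne hne⟩
      · exact .inr ⟨rfl, by simpa [swapBelow_eq_nil, swapBelow_length] using h⟩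
    · obtain ⟨rfl, v, rfl, hv⟩ := h
      exact ⟨rfl, _, swapEquiv_some n k v, by simp [hv, swapBelow]⟩
  refine ⟨fun h => ?_, key x y⟩
  simpa only [swapEquiv_swapEquiv] using key _ _ h

/-- The element `x` is not at or below the node `0ᵏ`. -/
def AvoidsZeros {n : ℕ} (k : ℕ) (x : Option (BWord n)) : Prop :=
  ∀ u : BWord n, x = some u → ¬ List.replicate k false <+: u.1

theorem AvoidsZeros.mono {n k m : ℕ} (hkm : k ≤ m) {x : Option (BWord n)}
    (h : AvoidsZeros k x) : AvoidsZeros m x := fun u hu hp =>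
  h u hu ((List.prefix_replicate_iff.mpr (by simp [hkm])).trans hp)

theorem AvoidsZeros.swapEquiv_eq {n k : ℕ} {x : Option (BWord n)} (h : AvoidsZeros k x) :
    swapEquiv n k x = x := by
  cases x with
  | none => rfl
  | some u => simp [swapEquiv_some, swapBelow_eq_self (h u rfl)]

theorem avoidsZeros_or_swapEquiv {n : ℕ} (k : ℕ) (x : Option (BWord n)) :
    AvoidsZeros (k + 1) x ∨ AvoidsZeros (k + 1) (swapEquiv n k x) := by
  refine or_iff_not_imp_left.mpr fun h => ?_
  simp only [AvoidsZeros, not_forall, not_not] at h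
  obtain ⟨u, rfl, hu⟩ := h
  rintro v hv
  rw [swapEquiv_some, Option.some_inj] at hv
  subst hv
  exact not_prefix_swapBelow hu

theorem AFrame_R_true_of_false {n : ℕ} {i : Fin 4} {x y : Option (BWord n)}
    (h : (AFrame n False).R i x y) : (AFrame n True).R i x y := by
  unfold AFrame at h ⊢
  dsimp only at h ⊢
  split_ifs at h ⊢
  · exact h.1.elim
  all_goals exact h

theorem AFrame_R_false_of_true {n k : ℕ} (hk : k ≤ n) {i : Fin 4} {x y : Option (BWord n)}
    (hx : AvoidsZeros k x) (h : (AFrame n True).R i x y) : (AFrame n False).R i x y := by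
  unfold AFrame at h ⊢
  dsimp only at h ⊢
  split_ifs at h ⊢
  · obtain ⟨-, ⟨u, rfl, hu⟩, -⟩ := h
    exact (hx.mono hk u rfl (by rw [hu])).elim
  all_goals exact h

theorem AvoidsZeros.succ_of_R {n k : ℕ} {i : Fin 4} {x y : Option (BWord n)}
    (hx : AvoidsZeros k x) (h : (AFrame n False).R i x y) : AvoidsZeros (k + 1) y := by
  unfold AFrame at h
  dsimp only at h
  split_ifs at h
  · exact h.1.elim
  · obtain ⟨u, v, rfl, rfl, h⟩ := h
    rintro _ ⟨⟩ hp
    rcases h with ⟨b, hb⟩ | ⟨-, hv⟩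
    · rw [hb] at hp
      have hlen := hp.length_le
      simp only [List.length_replicate, List.length_append, List.length_singleton] at hlen
      refine hx u rfl (List.prefix_of_prefix_length_le (l₃ := u.1 ++ [b]) ?_
        (List.prefix_append _ _) (by simp; omega))
      exact (List.prefix_replicate_iff.mpr (by simp)).trans hp
    · simp [hv, List.replicate_succ] at hp
  · obtain ⟨u, v, rfl, rfl, h⟩ := h
    rintro _ ⟨⟩ hp
    have hvu : v.1 <+: u.1 := by
      rcases h with ⟨h, -⟩ | ⟨rfl, -⟩
      · exact h
      · exact List.prefix_rfl
    exact hx.mono (Nat.le_succ k) u rfl (hp.trans hvu)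
  · obtain ⟨-, v, rfl, hv⟩ := h
    rintro _ ⟨⟩ hp
    simp [hv, List.replicate_succ] at hp

theorem AvoidsZeros.update {n k : ℕ} {φ : FO (Fin 4)} {g : ℕ → Option (BWord n)} {x : ℕ}
    {d : Option (BWord n)} (hg : ∀ z ∈ freeVars φ \ {x}, AvoidsZeros k (g z))
    (hd : AvoidsZeros (k + 1) d) :
    ∀ z ∈ freeVars φ, AvoidsZeros (k + 1) (Function.update g x d z) := by
  intro z hz
  by_cases hzx : z = x
  · subst hzx; simpa using hd
  · simpa [hzx] using (hg z (by simp [hz, hzx])).mono (Nat.le_succ k)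

/-- To verify a universally quantified formula in `AFrame n False`, it suffices to consider
values avoiding one more zero than the parameters do. -/
theorem FOSat_all_of_avoidsZeros {n k : ℕ} {φ : FO (Fin 4)} {g : ℕ → Option (BWord n)} {x : ℕ}
    (hg : ∀ z ∈ freeVars φ \ {x}, AvoidsZeros k (g z))
    (h : ∀ d, AvoidsZeros (k + 1) d → FOSat (AFrame n False) (Function.update g x d) φ) :
    FOSat (AFrame n False) g (.all x φ) := by
  intro (d : Option (BWord n))
  rcases avoidsZeros_or_swapEquiv k d with hd | hd
  · exact h d hd
  · rw [← FOSat_comp_equiv (AFrame n False) (swapEquiv n k) (AFrame_false_R_swapEquiv n k)]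
    refine (FOSat_congr _ _ _ _ fun z hz => ?_).mp (h _ hd)
    change Function.update g x (swapEquiv n k d) z = swapEquiv n k (Function.update g x d z)
    by_cases hzx : z = x
    · subst hzx; simp
    · simpa [hzx] using (hg z (by simp [hz, hzx])).swapEquiv_eq.symm

theorem ExBounded.transfer {n : ℕ} {φ : FO (Fin 4)} (hb : ExBounded φ) :
    ∀ (k : ℕ) (g : ℕ → Option (BWord n)), k + qrank φ ≤ n →
      (∀ z ∈ freeVars φ, AvoidsZeros k (g z)) →
      FOSat (AFrame n True) g φ → FOSat (AFrame n False) g φ := by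
  induction hb with
  | eq x y => exact fun k g _ _ h => h
  | neq x y => exact fun k g _ _ h => h
  | rel i x y =>
    exact fun k g hk hg h =>
      AFrame_R_false_of_true (le_of_add_le_left hk) (hg x (by simp [freeVars])) h
  | nrel i x y => exact fun k g _ _ h h' => h (AFrame_R_true_of_false h')
  | and _ _ ih₁ ih₂ =>
    intro k g hk hg h
    simp only [qrank] at hk
    exact ⟨ih₁ k g (by omega) (fun z hz => hg z (Finset.mem_union_left _ hz)) h.1,
      ih₂ k g (by omega) (fun z hz => hg z (Finset.mem_union_right _ hz)) h.2⟩
  | or _ _ ih₁ ih₂ =>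
    intro k g hk hg h
    simp only [qrank] at hk
    exact h.imp (ih₁ k g (by omega) (fun z hz => hg z (Finset.mem_union_left _ hz)))
      (ih₂ k g (by omega) (fun z hz => hg z (Finset.mem_union_right _ hz)))
  | @bex i y x φ hxy _ ih =>
    rintro k g hk hg ⟨d, hR, hd⟩
    simp only [qrank] at hk
    have hy : AvoidsZeros k (g y) := hg y (by simp [freeVars, hxy.symm])
    have hupd : Function.update g x d y = g y := Function.update_of_ne hxy.symm _ _
    have hupd' : Function.update g x d x = d := Function.update_self _ _ _
    have hR' : (AFrame n False).R i (Function.update g x d y) (Function.update g x d x) :=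
      AFrame_R_false_of_true (show k ≤ n by omega) (by rwa [hupd]) hR
    refine ⟨d, hR', ih (k + 1) _ (by omega) (AvoidsZeros.update (fun z hz => hg z ?_)
      (hy.succ_of_R (by rwa [hupd, hupd'] at hR'))) hd⟩
    simp only [freeVars, Finset.mem_sdiff, Finset.mem_union] at hz ⊢
    exact ⟨.inr hz.1, hz.2⟩
  | @ball i y x φ hxy _ ih =>
    intro k g hk hg h
    simp only [qrank] at hk
    refine FOSat_all_of_avoidsZeros hg fun d hd hR => ?_
    refine ih (k + 1) _ (by omega) (fun z hz => AvoidsZeros.update hg hd z ?_)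
      (h d (AFrame_R_true_of_false hR))
    exact Finset.mem_union_right _ hz
  | @uall x φ _ ih =>
    intro k g hk hg h
    simp only [qrank] at hk
    exact FOSat_all_of_avoidsZeros hg fun d hd =>
      ih (k + 1) _ (by omega) (AvoidsZeros.update hg hd) (h d)

/-- Lemma 3.6: every ∃-bounded first-order sentence of quantifier rank at most
`n` that is true in `𝔄ₙ` is also true in `𝔅ₙ`. -/
theorem exBounded_transfer_An_Bn (n : ℕ) (hn : 1 ≤ n) (θ : FO (Fin 4))
    (hb : ExBounded θ) (hsent : freeVars θ = ∅) (hqr : qrank θ ≤ n) :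
    FrameSat (AFrame n True) θ → FrameSat (AFrame n False) θ := by
  intro h g
  exact hb.transfer 0 g (by omega) (by simp [hsent]) (h g)
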